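/- For all integers n and ℓ with 1 ≤ ℓ ≤ n and every nonzero complex number a, the polynomial q(z) = z^n - f_{n,ℓ}(z) has degree exactly n - ℓ (with leading coefficient a^ℓ·binom(n, ℓ)). -/

import Mathlib

open Polynomial

/-- `P n ℓ a` is the polynomial `P_{n,ℓ}(z) = ∑_{k=0}^{ℓ-1} C(n-ℓ+k, k) a^k z^{ℓ-1-k}`. -/
noncomputable def P (n ℓ : ℕ) (a : ℂ) : Polynomial ℂ :=
  ∑ k ∈ Finset.range ℓ, C ((Nat.choose (n - ℓ + k) k : ℂ) * a ^ k) * X ^ (ℓ - 1 - k)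

/-- `f n ℓ a` is the polynomial `f_{n,ℓ}(z) = (z - a)^{n-ℓ+1}·P_{n,ℓ}(z)`. -/
noncomputable def f (n ℓ : ℕ) (a : ℂ) : Polynomial ℂ :=
  (X - C a) ^ (n - ℓ + 1) * P n ℓ a

lemma pascal_step {R : Type*} [CommRing R] (Y A : R) (N : ℕ) : ∀ M : ℕ, M ≤ N →
    (Y + A) * ∑ j ∈ Finset.range (M + 1), (Nat.choose N j : R) * A ^ (N - j) * Y ^ j =
    ∑ j ∈ Finset.range (M + 1), (Nat.choose (N + 1) j : R) * A ^ (N + 1 - j) * Y ^ j +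
      (Nat.choose N M : R) * A ^ (N - M) * Y ^ (M + 1) := by
  intro M
  induction M with
  | zero => intro _; simp; ring
  | succ M ih =>
    intro h
    rw [Finset.sum_range_succ, mul_add, ih (by omega),
      Finset.sum_range_succ _ (M + 1), Nat.choose_succ_succ]
    obtain ⟨d, rfl⟩ := Nat.exists_eq_add_of_le h
    have h1 : M + 1 + d - M = d + 1 := by omega
    have h2 : M + 1 + d - (M + 1) = d := by omega
    have h3 : M + 1 + d + 1 - (M + 1) = d + 1 := by omega
    rw [h1, h2, h3]
    push_cast
    ring

lemma P_succ (m l : ℕ) (a : ℂ) :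
    P (m + (l + 1)) (l + 1) a = X * P (m + l) l a + C ((Nat.choose (m + l) l : ℂ) * a ^ l) := by
  unfold P
  rw [Finset.sum_range_succ, Finset.mul_sum]
  congr 1
  · refine Finset.sum_congr rfl fun k hk => ?_
    have hk := Finset.mem_range.1 hk
    have h1 : l + 1 - 1 - k = (l - 1 - k) + 1 := by omega
    rw [h1, Nat.add_sub_cancel, Nat.add_sub_cancel]
    ring
  · simp

lemma q_expand (m : ℕ) (a : ℂ) : ∀ l : ℕ,
    X ^ (m + l) - f (m + l) l a =
    ∑ j ∈ Finset.range (m + 1),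
      (Nat.choose (m + l) j : Polynomial ℂ) * (C a) ^ (m + l - j) * (X - C a) ^ j := by
  intro l
  induction l with
  | zero =>
    have h := add_pow (X - C a) (C a) m
    rw [sub_add_cancel] at h
    simp only [f, P, Finset.range_zero, Finset.sum_empty, mul_zero, sub_zero, add_zero]
    rw [h]
    exact Finset.sum_congr rfl fun k _ => by ring
  | succ l ih =>
    have h := pascal_step (X - C a) (C a) (m + l) m (by omega)
    rw [← ih, sub_add_cancel] at h
    have e : m + (l + 1) = m + l + 1 := by ring
    have hc : (m + l).choose l = (m + l).choose m := by
      rw [Nat.choose_symm_add]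
    rw [e, ← sub_eq_iff_eq_add.2 h, ← e]
    unfold f
    rw [P_succ, hc]
    simp only [Nat.add_sub_cancel, Nat.add_sub_cancel_left, map_mul, map_pow, map_natCast]
    ring

/-- For `1 ≤ ℓ ≤ n` and `a ≠ 0`, the polynomial `q(z) = z^n - f_{n,ℓ}(z)` has degree exactly
`n - ℓ`, with leading coefficient `a^ℓ·binom(n,ℓ)`. -/
theorem q_degree (n ℓ : ℕ) (hℓ : 1 ≤ ℓ) (hn : ℓ ≤ n) (a : ℂ) (ha : a ≠ 0) :
    (X ^ n - f n ℓ a).natDegree = n - ℓ ∧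
    (X ^ n - f n ℓ a).leadingCoeff = a ^ ℓ * (Nat.choose n ℓ : ℂ) := by
  obtain ⟨m, rfl⟩ := Nat.exists_eq_add_of_le' hn
  have hc : (m + ℓ).choose ℓ = (m + ℓ).choose m := by
    rw [Nat.choose_symm_add]
  have hc0 : a ^ ℓ * ((m + ℓ).choose m : ℂ) ≠ 0 :=
    mul_ne_zero (pow_ne_zero _ ha)
      (Nat.cast_ne_zero.2 (Nat.choose_pos (Nat.le_add_right _ _)).ne')
  rw [q_expand, hc, Nat.add_sub_cancel, Finset.sum_range_succ, Nat.add_sub_cancel_left]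
  have e : ((m + ℓ).choose m : Polynomial ℂ) * (C a) ^ ℓ * (X - C a) ^ m =
      C (a ^ ℓ * ((m + ℓ).choose m : ℂ)) * (X - C a) ^ m := by
    simp only [map_mul, map_pow, map_natCast]
    ring
  have hd : (C (a ^ ℓ * ((m + ℓ).choose m : ℂ)) * (X - C a) ^ m).degree = (m : WithBot ℕ) := by
    rw [degree_C_mul hc0, degree_pow, degree_X_sub_C]
    simp
  have hl : (C (a ^ ℓ * ((m + ℓ).choose m : ℂ)) * (X - C a) ^ m).leadingCoeff =
      a ^ ℓ * ((m + ℓ).choose m : ℂ) := by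
    rw [leadingCoeff_mul, leadingCoeff_C, leadingCoeff_pow, leadingCoeff_X_sub_C]
    simp
  have hlt : (∑ j ∈ Finset.range m, ((m + ℓ).choose j : Polynomial ℂ) * (C a) ^ (m + ℓ - j) *
      (X - C a) ^ j).degree < (m : WithBot ℕ) := by
    rw [← mem_degreeLT]
    refine Submodule.sum_mem _ fun j hj => ?_
    rw [mem_degreeLT]
    have e2 : ((m + ℓ).choose j : Polynomial ℂ) * (C a) ^ (m + ℓ - j) * (X - C a) ^ j =
        C (((m + ℓ).choose j : ℂ) * a ^ (m + ℓ - j)) * (X - C a) ^ j := by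
      simp only [map_mul, map_pow, map_natCast]
    rw [e2]
    have hj' := Finset.mem_range.1 hj
    rw [degree_C_mul (mul_ne_zero (Nat.cast_ne_zero.2 (Nat.choose_pos (by omega)).ne')
      (pow_ne_zero _ ha)), degree_pow, degree_X_sub_C]
    simpa using hj
  rw [e]
  rw [← hd] at hlt
  constructor
  · apply natDegree_eq_of_degree_eq_some
    rw [degree_add_eq_right_of_degree_lt hlt, hd]
  · rw [leadingCoeff_add_of_degree_lt hlt, hl]
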